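/- Fix M ≥ 1, N_t ≥ 1, reals β_1,...,β_M > 0, δ_1,...,δ_M > 0, a power budget P > 0, and Hermitian positive semidefinite complex N_t×N_t matrices A_1,...,A_M, and assume additionally that Σ_{m=1}^M β_m A_m is positive definite. If R★ is an N_t×N_t complex positive semidefinite matrix with Re(tr R★) ≤ P that minimizes f(R) = Σ_{m=1}^M (β_m · Re(tr(A_m R)) + δ_m)⁻¹ over all such matrices, then Re(tr R★) = P (the transmit power constraint is active at the optimum). -/

import Mathlib

open Matrix ComplexOrder

lemma trace_mul_re_nonneg_aux {n : ℕ} {A R : Matrix (Fin n) (Fin n) ℂ}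
    (hA : A.PosSemidef) (hR : R.PosSemidef) : 0 ≤ (Matrix.trace (A * R)).re := by
  obtain ⟨B, rfl⟩ : ∃ B : Matrix (Fin n) (Fin n) ℂ, R = Bᴴ * B := by
    open scoped MatrixOrder in
    exact CStarAlgebra.nonneg_iff_eq_star_mul_self.mp hR.nonneg
  have h := (hA.mul_mul_conjTranspose_same B).trace_nonneg
  rw [← Matrix.mul_assoc, Matrix.trace_mul_comm, ← Matrix.mul_assoc]
  exact (Complex.le_def.mp h).1

/-- if `Σ_m β_m A_m` is positive definite, then any minimizer of Problem
(P1) uses the full power budget: `Re(tr R★) = P`. -/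
theorem stmt_8 {M Nt : ℕ} (hM : 1 ≤ M) (hNt : 1 ≤ Nt)
    (β δ : Fin M → ℝ) (hβ : ∀ m, 0 < β m) (hδ : ∀ m, 0 < δ m)
    {P : ℝ} (hP : 0 < P)
    (A : Fin M → Matrix (Fin Nt) (Fin Nt) ℂ) (hA : ∀ m, (A m).PosSemidef)
    (hsum : (∑ m, β m • A m).PosDef)
    (Rstar : Matrix (Fin Nt) (Fin Nt) ℂ) (hRstar : Rstar.PosSemidef)
    (htr : (Matrix.trace Rstar).re ≤ P)
    (hopt : ∀ R : Matrix (Fin Nt) (Fin Nt) ℂ, R.PosSemidef → (Matrix.trace R).re ≤ P →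
      ∑ m, (β m * (Matrix.trace (A m * Rstar)).re + δ m)⁻¹ ≤
      ∑ m, (β m * (Matrix.trace (A m * R)).re + δ m)⁻¹) :
    (Matrix.trace Rstar).re = P := by
  by_contra hne
  have hlt : (Matrix.trace Rstar).re < P := lt_of_le_of_ne htr hne
  have hN : (0 : ℝ) < Nt := by exact_mod_cast hNt
  haveI : Nonempty (Fin Nt) := ⟨⟨0, hNt⟩⟩
  obtain ⟨ε, hε⟩ : ∃ ε : ℝ, ε = (P - (Matrix.trace Rstar).re) / Nt := ⟨_, rfl⟩
  have hεpos : 0 < ε := by rw [hε]; exact div_pos (by linarith) hN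
  have hεN : ε * Nt = P - (Matrix.trace Rstar).re := by rw [hε]; field_simp
  have hApos : ∀ m, 0 ≤ (Matrix.trace (A m)).re := fun m =>
    (Complex.le_def.mp (hA m).trace_nonneg).1
  have hsumpos : 0 < ∑ m, β m * (Matrix.trace (A m)).re := by
    have h := (Complex.lt_def.mp hsum.trace_pos).1
    simpa [Matrix.trace_sum, Matrix.trace_smul] using h
  obtain ⟨m₀, -, hm₀⟩ := Finset.exists_lt_of_sum_lt
    (s := Finset.univ) (f := fun _ : Fin M => (0 : ℝ)) (by simpa using hsumpos)
  have hI : ((ε : ℂ) • (1 : Matrix (Fin Nt) (Fin Nt) ℂ)).PosSemidef :=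
    Matrix.PosSemidef.one.smul (by exact_mod_cast hεpos.le)
  have key := hopt (Rstar + (ε : ℂ) • 1) (hRstar.add hI) (by
    simp [Matrix.trace_add, Matrix.trace_smul]
    linarith)
  have hval : ∀ m, (Matrix.trace (A m * (Rstar + (ε : ℂ) • 1))).re
      = (Matrix.trace (A m * Rstar)).re + ε * (Matrix.trace (A m)).re := fun m => by
    simp [Matrix.mul_add, Matrix.trace_add, Matrix.trace_smul]
  have hpos : ∀ m, 0 < β m * (Matrix.trace (A m * Rstar)).re + δ m := fun m =>
    add_pos_of_nonneg_of_pos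
      (mul_nonneg (hβ m).le (trace_mul_re_nonneg_aux (hA m) hRstar)) (hδ m)
  refine absurd key (not_le.mpr (Finset.sum_lt_sum (fun m _ => ?_) ⟨m₀, Finset.mem_univ _, ?_⟩))
  · rw [hval]
    refine inv_anti₀ (hpos m) ?_
    have := mul_nonneg (hβ m).le (mul_nonneg hεpos.le (hApos m))
    linarith
  · rw [hval]
    refine inv_strictAnti₀ (hpos m₀) ?_
    have := mul_pos hεpos hm₀
    linarith
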